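/- arXiv:2111.14649 — 3 statements merged into one kernel-verified Lean document; each statement's English description precedes it below -/
import Mathlib

section
/- Let L = ⊕_{i=0}^{n−1} L_i be a (ℤ/nℤ)-graded Lie type algebra with L_0 = 0. If at most d ≤ n−1 of the components L_i are nonzero, then L is solvable of derived length bounded by a function of d alone (in fact L^{(2^d − 1)} = 0). -/
/-- Derived series: `ds b 0 = L`, `ds b (m+1) = [ds b m, ds b m]`. -/
def ds {K L : Type*} [Field K] [AddCommGroup L] [Module K L]
    (b : L →ₗ[K] L →ₗ[K] L) : ℕ → Submodule K L
  | 0 => ⊤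
  | m + 1 => Submodule.map₂ b (ds b m) (ds b m)

/-- Homogeneous derived family. -/
def DF {K L : Type*} [Field K] [AddCommGroup L] [Module K L]
    (b : L →ₗ[K] L →ₗ[K] L) {n : ℕ} (M : ZMod n → Submodule K L) : ZMod n → Submodule K L :=
  fun i => ⨆ a, Submodule.map₂ b (M a) (M (i - a))

/-- Homogeneous elements of the subalgebra generated by components of index above `k`. -/
inductive Alg {K L : Type*} [Field K] [AddCommGroup L] [Module K L]
    (b : L →ₗ[K] L →ₗ[K] L) {n : ℕ} (M : ZMod n → Submodule K L) (k : ℕ) : ZMod n → L → Prop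
  | gen (j : ZMod n) (x : L) : k < j.val → x ∈ M j → Alg b M k j x
  | zero (i : ZMod n) : Alg b M k i 0
  | add (i : ZMod n) (x y : L) : Alg b M k i x → Alg b M k i y → Alg b M k i (x + y)
  | smul (i : ZMod n) (c : K) (x : L) : Alg b M k i x → Alg b M k i (c • x)
  | mul (i j : ZMod n) (x y : L) : Alg b M k i x → Alg b M k j y → Alg b M k (i + j) (b x y)

section
variable {K L : Type*} [Field K] [AddCommGroup L] [Module K L]
    (b : L →ₗ[K] L →ₗ[K] L) {n : ℕ}

/-- `Alg` as a submodule. -/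
def AlgS (M : ZMod n → Submodule K L) (k : ℕ) (i : ZMod n) : Submodule K L where
  carrier := {x | Alg b M k i x}
  zero_mem' := Alg.zero i
  add_mem' := fun hx hy => Alg.add i _ _ hx hy
  smul_mem' := fun c _ hx => Alg.smul i c _ hx

/-- Graded closedness. -/
def Closed (M : ZMod n → Submodule K L) : Prop :=
  ∀ i j : ZMod n, ∀ x ∈ M i, ∀ y ∈ M j, b x y ∈ M (i + j)

lemma DF_mem (M : ZMod n → Submodule K L) {i j : ZMod n} {x y : L} (hx : x ∈ M i)
    (hy : y ∈ M j) : b x y ∈ DF b M (i + j) := by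
  refine Submodule.mem_iSup_of_mem i ?_
  apply Submodule.apply_mem_map₂ _ hx
  simpa using hy

lemma DF_le {M : ZMod n → Submodule K L} (hM : Closed b M) : DF b M ≤ M := by
  intro i
  refine iSup_le fun a => Submodule.map₂_le.2 fun x hx y hy => ?_
  simpa using hM _ _ x hx y hy

lemma DF_closed {M : ZMod n → Submodule K L} (hM : Closed b M) : Closed b (DF b M) :=
  fun _ _ _ hx _ hy => DF_mem b M (DF_le b hM _ hx) (DF_le b hM _ hy)

lemma DFi_closed {M : ZMod n → Submodule K L} (hM : Closed b M) (e : ℕ) :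
    Closed b ((DF b)^[e] M) ∧ (DF b)^[e] M ≤ M := by
  induction e with
  | zero => exact ⟨hM, le_rfl⟩
  | succ e ih =>
    rw [Function.iterate_succ_apply']
    exact ⟨DF_closed b ih.1, (DF_le b ih.1).trans ih.2⟩

lemma Alg_sub {M N : ZMod n → Submodule K L} {k l : ℕ}
    (h : ∀ j : ZMod n, k < j.val → ∀ x ∈ M j, Alg b N l j x) {i : ZMod n} {x : L}
    (hx : Alg b M k i x) : Alg b N l i x := by
  induction hx with
  | gen j x hj hx => exact h j hj x hx
  | zero i => exact Alg.zero i
  | add i x y _ _ h1 h2 => exact Alg.add i x y h1 h2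
  | smul i c x _ h1 => exact Alg.smul i c x h1
  | mul i j x y _ _ h1 h2 => exact Alg.mul i j x y h1 h2

lemma Alg_mem {M : ZMod n → Submodule K L} (hM : Closed b M) {k : ℕ} {i : ZMod n} {x : L}
    (hx : Alg b M k i x) : x ∈ M i := by
  induction hx with
  | gen j x hj hx => exact hx
  | zero i => exact zero_mem _
  | add i x y _ _ h1 h2 => exact add_mem h1 h2
  | smul i c x _ h1 => exact Submodule.smul_mem _ c h1
  | mul i j x y _ _ h1 h2 => exact hM _ _ x h1 y h2

/-- Sums of products whose last factor has index above `k`. -/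
def RR (M : ZMod n → Submodule K L) (k : ℕ) (i : ZMod n) : Submodule K L :=
  ⨆ j : ZMod n, ⨆ _ : k < j.val, Submodule.map₂ b (M (i - j)) (M j)

lemma step1 (hLT : ∀ x y z : L, ∃ α β : K, α ≠ 0 ∧
      b (b x y) z = α • b x (b y z) + β • b (b x z) y)
    {M : ZMod n → Submodule K L} (hM : Closed b M) {k : ℕ} {c : ZMod n} {y : L}
    (hy : Alg b M k c y) : ∀ (a : ZMod n), ∀ x ∈ M a, b x y ∈ RR b M k (a + c) := by
  induction hy with
  | gen j y hj hy =>
    intro a x hx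
    refine Submodule.mem_iSup_of_mem j (Submodule.mem_iSup_of_mem hj ?_)
    exact Submodule.apply_mem_map₂ _ (by simpa using hx) hy
  | zero i => intro a x hx; simp
  | add i y z _ _ h1 h2 =>
    intro a x hx
    rw [map_add]
    exact add_mem (h1 a x hx) (h2 a x hx)
  | smul i c y _ h1 =>
    intro a x hx
    rw [map_smul]
    exact Submodule.smul_mem _ c (h1 a x hx)
  | mul i j u v hu hv h1 h2 =>
    intro a x hx
    obtain ⟨α, β, hα, h⟩ := hLT x u v
    have e : b x (b u v) = α⁻¹ • (b (b x u) v - β • b (b x v) u) := by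
      rw [h, add_sub_cancel_right, smul_smul, inv_mul_cancel₀ hα, one_smul]
    rw [e]
    have p1 := h2 (a + i) (b x u) (hM _ _ x hx u (Alg_mem b hM hu))
    have p2 := h1 (a + j) (b x v) (hM _ _ x hx v (Alg_mem b hM hv))
    rw [add_assoc] at p1
    rw [add_assoc, add_comm j i] at p2
    exact Submodule.smul_mem _ _ (sub_mem p1 (Submodule.smul_mem _ _ p2))

lemma step2 [NeZero n] {M : ZMod n → Submodule K L} (h0 : M 0 = ⊥)
    {k : ℕ} {m : ZMod n} (hm : m.val = k + 1) : RR b M k m ≤ AlgS b M (k + 1) m := by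
  refine iSup_le fun j => iSup_le fun hj => Submodule.map₂_le.2 fun x hx y hy => ?_
  by_cases hjm : j = m
  · subst hjm
    rw [sub_self, h0, Submodule.mem_bot] at hx
    subst hx
    simp
  · have hne : j.val ≠ m.val := fun h => hjm (ZMod.val_injective n h)
    have hjn := ZMod.val_lt j
    have h2 : (m - j).val + j.val = m.val ∨ (m - j).val + j.val = m.val + n := by
      have h3 := ZMod.val_add (m - j) j
      rw [sub_add_cancel] at h3
      have h4 := ZMod.val_lt (m - j)
      rcases lt_or_ge ((m - j).val + j.val) n with h5 | h5
      · rw [Nat.mod_eq_of_lt h5] at h3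
        omega
      · rw [Nat.mod_eq_sub_mod h5, Nat.mod_eq_of_lt (by omega)] at h3
        omega
    have : Alg b M (k + 1) ((m - j) + j) (b x y) :=
      Alg.mul _ _ _ _ (Alg.gen _ _ (by omega) hx) (Alg.gen _ _ (by omega) hy)
    rw [sub_add_cancel] at this
    exact this

lemma main_step [NeZero n] (hLT : ∀ x y z : L, ∃ α β : K, α ≠ 0 ∧
      b (b x y) z = α • b x (b y z) + β • b (b x z) y)
    (S : Finset (ZMod n)) (k : ℕ) (hk : k < n) :
    ∀ M : ZMod n → Submodule K L, Closed b M → M 0 = ⊥ → (∀ i ∉ S, M i = ⊥) →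
    ∀ i, ∀ x ∈ (DF b)^[2 ^ (S.filter (fun j => j.val ≤ k)).card - 1] M i, Alg b M k i x := by
  induction k with
  | zero =>
    intro M hM h0 hS i x hx
    have hx' := (DFi_closed b hM _).2 i hx
    by_cases hi : i = 0
    · subst hi
      rw [h0, Submodule.mem_bot] at hx'
      subst hx'
      exact Alg.zero _
    · exact Alg.gen _ _ (Nat.pos_of_ne_zero (by simpa using hi)) hx'
  | succ k ih =>
    intro M hM h0 hS i x hx
    have ih := ih (by omega)
    obtain ⟨m, hm⟩ : ∃ m : ZMod n, m.val = k + 1 := ⟨((k + 1 : ℕ) : ZMod n),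
      ZMod.val_cast_of_lt hk⟩
    have hmj : ∀ j : ZMod n, k < j.val → j = m ∨ k + 1 < j.val := by
      intro j hj
      by_cases h : j.val = k + 1
      · left; exact ZMod.val_injective n (h.trans hm.symm)
      · right; omega
    by_cases hmS : m ∈ S
    · have hc : (S.filter (fun j => j.val ≤ k + 1)).card
          = (S.filter (fun j => j.val ≤ k)).card + 1 := by
        rw [← Finset.card_insert_of_notMem (a := m) (by simp [hm])]
        congr 1
        ext j
        simp only [Finset.mem_filter, Finset.mem_insert]
        constructor
        · rintro ⟨h1, h2⟩
          by_cases h : j.val ≤ k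
          · exact Or.inr ⟨h1, h⟩
          · rcases hmj j (by omega) with h | h
            · exact Or.inl h
            · omega
        · rintro (h | ⟨h1, h2⟩)
          · subst h; exact ⟨hmS, hm.le⟩
          · exact ⟨h1, by omega⟩
      rw [hc] at hx
      set e := 2 ^ (S.filter (fun j => j.val ≤ k)).card - 1 with he
      have hE : 2 ^ ((S.filter (fun j => j.val ≤ k)).card + 1) - 1 = e + (1 + e) := by
        have := Nat.one_le_two_pow (n := (S.filter (fun j => j.val ≤ k)).card)
        rw [pow_succ]; omega
      rw [hE, Function.iterate_add_apply, Function.iterate_add_apply,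
        Function.iterate_one] at hx
      obtain ⟨c1, c2⟩ := DFi_closed b hM e
      have hle : DF b ((DF b)^[e] M) ≤ M := (DF_le b c1).trans c2
      have h1 := ih (DF b ((DF b)^[e] M)) (DF_closed b c1)
        (le_bot_iff.1 (h0 ▸ hle 0)) (fun i hi => le_bot_iff.1 (hS i hi ▸ hle i)) i x hx
      refine Alg_sub b ?_ h1
      intro j hj z hz
      rcases hmj j hj with h | h
      · subst h
        have : DF b ((DF b)^[e] M) j ≤ AlgS b M (k + 1) j := by
          refine iSup_le fun a => Submodule.map₂_le.2 fun x hx y hy => ?_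
          have h5 := step1 b hLT hM (ih M hM h0 hS _ y hy) a x (c2 a hx)
          rw [add_sub_cancel] at h5
          exact step2 b h0 hm h5
        exact this hz
      · exact Alg.gen _ _ h (hle j hz)
    · have hc : S.filter (fun j => j.val ≤ k + 1) = S.filter (fun j => j.val ≤ k) := by
        ext j
        simp only [Finset.mem_filter]
        constructor
        · rintro ⟨h1, h2⟩
          refine ⟨h1, ?_⟩
          by_contra h
          rcases hmj j (by omega) with h | h
          · subst h; exact hmS h1
          · omega
        · rintro ⟨h1, h2⟩; exact ⟨h1, by omega⟩
      rw [hc] at hx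
      refine Alg_sub b ?_ (ih M hM h0 hS i x hx)
      intro j hj z hz
      rcases hmj j hj with h | h
      · subst h
        rw [hS _ hmS, Submodule.mem_bot] at hz
        subst hz
        exact Alg.zero _
      · exact Alg.gen _ _ h hz

lemma ds_le_DF (M : ZMod n → Submodule K L) (hM : iSup M = ⊤) (e : ℕ) :
    ds b e ≤ ⨆ i, (DF b)^[e] M i := by
  induction e with
  | zero => exact le_of_le_of_eq le_top hM.symm
  | succ e ih =>
    rw [Function.iterate_succ_apply']
    refine (Submodule.map₂_le_map₂ ih ih).trans ?_
    rw [Submodule.map₂_iSup_left]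
    refine iSup_le fun i => ?_
    rw [Submodule.map₂_iSup_right]
    refine iSup_le fun j => Submodule.map₂_le.2 fun x hx y hy => ?_
    exact Submodule.mem_iSup_of_mem (i + j) (DF_mem b _ hx hy)

lemma ds_succ_le (e : ℕ) : ds b (e + 1) ≤ ds b e := by
  induction e with
  | zero => exact le_top
  | succ e ih => exact Submodule.map₂_le_map₂ ih ih

end

/-- Shalev–Kreknin analogue. Let `L = ⊕ L_i` be a `(ℤ/nℤ)`-graded
Lie type algebra with `L₀ = 0`. If at most `d ≤ n-1` of the components are nonzero,
then `L` is solvable of derived length bounded in terms of `d` alone: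
in fact `L^{(2^d - 1)} = 0`. -/
theorem stmt8 {K L : Type*} [Field K] [AddCommGroup L] [Module K L]
    (b : L →ₗ[K] L →ₗ[K] L)
    (hLT : ∀ x y z : L, ∃ α β : K, α ≠ 0 ∧
      b (b x y) z = α • b x (b y z) + β • b (b x z) y)
    (n d : ℕ) (hn : 0 < n) (hd : d ≤ n - 1)
    (Lc : ZMod n → Submodule K L)
    (hinternal : DirectSum.IsInternal Lc)
    (hmul : ∀ i j : ZMod n, Submodule.map₂ b (Lc i) (Lc j) ≤ Lc (i + j))
    (h0 : Lc 0 = ⊥)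
    (hcard : {i : ZMod n | Lc i ≠ ⊥}.ncard ≤ d) :
    ds b (2 ^ d - 1) = ⊥ := by
  classical
  haveI : NeZero n := ⟨hn.ne'⟩
  set S : Finset (ZMod n) := Finset.univ.filter (fun i => Lc i ≠ ⊥) with hSdef
  have hSc : S.card ≤ d := by
    have : {i : ZMod n | Lc i ≠ ⊥} = (S : Set (ZMod n)) := by ext; simp [hSdef]
    rwa [this, Set.ncard_coe_finset] at hcard
  have hM : Closed b Lc := fun i j x hx y hy => hmul i j (Submodule.apply_mem_map₂ _ hx hy)
  have key := main_step b hLT S (n - 1) (by omega) Lc hM h0 (by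
    intro i hi
    by_contra h
    exact hi (by simp [hSdef, h]))
  set e := 2 ^ (S.filter (fun j => j.val ≤ n - 1)).card - 1 with he
  have hed : e ≤ 2 ^ d - 1 := by
    apply Nat.sub_le_sub_right
    exact Nat.pow_le_pow_right (by norm_num) ((Finset.card_filter_le _ _).trans hSc)
  rw [← le_bot_iff]
  refine (antitone_nat_of_succ_le (ds_succ_le b) hed).trans ?_
  refine (ds_le_DF b Lc hinternal.submodule_iSup_eq_top e).trans ?_
  refine iSup_le fun i x hx => ?_
  have h1 : Alg b (fun _ : ZMod n => (⊥ : Submodule K L)) 0 i x := by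
    refine Alg_sub b ?_ (key i x hx)
    intro j hj
    have := ZMod.val_lt j
    omega
  exact Alg_mem b (M := fun _ => ⊥) (by
    intro i j x hx y hy
    rw [Submodule.mem_bot] at hx ⊢
    simp [hx]) h1
end

section
/- Let L = ⊕_{i=0}^{n−1} L_i be a (ℤ/nℤ)-graded Lie type algebra with L_0 = 0, and let 0 < w_1 < w_2 < ⋯ < w_d < n be the indices of all nonzero components. Then for every k with 1 ≤ k ≤ d: (i) L^{(2^{k−1})} ∩ L_{w_k} is contained in the subalgebra generated by L_{w_{k+1}},…,L_{w_d}, and (ii) L^{(2^k − 1)} is contained in the subalgebra generated by L_{w_{k+1}},…,L_{w_d}. -/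
/-- The subalgebra (as a submodule closed under the product) generated by a subspace. -/
def genSubalg {K L : Type*} [Field K] [AddCommGroup L] [Module K L]
    (b : L →ₗ[K] L →ₗ[K] L) (A : Submodule K L) : Submodule K L :=
  sInf {P : Submodule K L | A ≤ P ∧ Submodule.map₂ b P P ≤ P}


/-- Derived series of a submodule. -/
def dsM {K L : Type*} [Field K] [AddCommGroup L] [Module K L]
    (b : L →ₗ[K] L →ₗ[K] L) (M : Submodule K L) : ℕ → Submodule K L
  | 0 => M
  | m + 1 => Submodule.map₂ b (dsM b M m) (dsM b M m)

/-- Sum of the components of `M` of index at least `k`. -/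
def topPart {K L : Type*} [Field K] [AddCommGroup L] [Module K L] {n d : ℕ}
    (Lc : ZMod n → Submodule K L) (w : Fin d → ℕ) (M : Submodule K L) (k : ℕ) :
    Submodule K L :=
  ⨆ j : Fin d, ⨆ _ : k ≤ (j : ℕ), M ⊓ Lc ((w j : ZMod n))

section aux
variable {K L : Type*} [Field K] [AddCommGroup L] [Module K L]
  (b : L →ₗ[K] L →ₗ[K] L)

theorem dsM_top (m : ℕ) : dsM b ⊤ m = ds b m := by
  induction m with
  | zero => rfl
  | succ m ih => simp only [dsM, ds, ih]

theorem dsM_add (M : Submodule K L) (a m : ℕ) : dsM b (dsM b M a) m = dsM b M (a + m) := by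
  induction m with
  | zero => rfl
  | succ m ih => rw [← add_assoc]; simp only [dsM, ih]

theorem dsM_closed (M : Submodule K L) (hM : Submodule.map₂ b M M ≤ M) (m : ℕ) :
    Submodule.map₂ b (dsM b M m) (dsM b M m) ≤ dsM b M m := by
  induction m with
  | zero => exact hM
  | succ m ih => exact Submodule.map₂_le_map₂ ih ih

theorem dsM_le (M : Submodule K L) (hM : Submodule.map₂ b M M ≤ M) (m : ℕ) :
    dsM b M m ≤ M := by
  induction m with
  | zero => exact le_rfl
  | succ m ih => exact (dsM_closed b M hM m).trans ih

theorem le_gen (A : Submodule K L) : A ≤ genSubalg b A :=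
  le_sInf fun _ hP => hP.1

theorem gen_closed (A : Submodule K L) :
    Submodule.map₂ b (genSubalg b A) (genSubalg b A) ≤ genSubalg b A := by
  refine le_sInf fun P hP => ?_
  exact (Submodule.map₂_le_map₂ (sInf_le hP) (sInf_le hP)).trans hP.2

theorem gen_le (A P : Submodule K L) (h1 : A ≤ P) (h2 : Submodule.map₂ b P P ≤ P) :
    genSubalg b A ≤ P := sInf_le ⟨h1, h2⟩

theorem mul_gen_le
    (hLT : ∀ x y z : L, ∃ α β : K, α ≠ 0 ∧
      b (b x y) z = α • b x (b y z) + β • b (b x z) y)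
    (M A : Submodule K L) (hM : Submodule.map₂ b M M ≤ M) (hA : A ≤ M) :
    Submodule.map₂ b M (genSubalg b A) ≤ Submodule.map₂ b M A := by
  have hM' : ∀ x ∈ M, ∀ y ∈ M, b x y ∈ M := Submodule.map₂_le.1 hM
  let P : Submodule K L :=
    { carrier := {h | h ∈ M ∧ ∀ x ∈ M, b x h ∈ Submodule.map₂ b M A}
      zero_mem' := ⟨M.zero_mem, fun x _ => by simp⟩
      add_mem' := fun {y z} hy hz => ⟨M.add_mem hy.1 hz.1, fun x hx => by
        rw [map_add]; exact Submodule.add_mem _ (hy.2 x hx) (hz.2 x hx)⟩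
      smul_mem' := fun c y hy => ⟨M.smul_mem c hy.1, fun x hx => by
        rw [map_smul]; exact Submodule.smul_mem _ c (hy.2 x hx)⟩ }
  have hP : genSubalg b A ≤ P := by
    refine gen_le b A P (fun a ha => ⟨hA ha, fun x hx => Submodule.apply_mem_map₂ b hx ha⟩) ?_
    refine Submodule.map₂_le.2 fun y hy z hz => ⟨hM' y hy.1 z hz.1, fun x hx => ?_⟩
    obtain ⟨α, β, hα, h⟩ := hLT x y z
    have : b x (b y z) = α⁻¹ • (b (b x y) z - β • b (b x z) y) := by
      rw [h, add_sub_cancel_right, smul_smul, inv_mul_cancel₀ hα, one_smul]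
    rw [this]
    exact Submodule.smul_mem _ _ (Submodule.sub_mem _ (hz.2 _ (hM' x hx y hy.1))
      (Submodule.smul_mem _ _ (hy.2 _ (hM' x hx z hz.1))))
  exact Submodule.map₂_le.2 fun x hx h hh => (hP hh).2 x hx

variable {n d : ℕ} (Lc : ZMod n → Submodule K L) (w : Fin d → ℕ)

theorem topPart_le (M : Submodule K L) (k : ℕ) : topPart Lc w M k ≤ M :=
  iSup_le fun _ => iSup_le fun _ => inf_le_left

theorem dsM_homog (hmul : ∀ i j : ZMod n, Submodule.map₂ b (Lc i) (Lc j) ≤ Lc (i + j))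
    (M : Submodule K L) (hM : M ≤ ⨆ i, M ⊓ Lc i) (m : ℕ) :
    dsM b M m ≤ ⨆ i, dsM b M m ⊓ Lc i := by
  induction m with
  | zero => exact hM
  | succ m ih =>
    have h : dsM b M (m + 1) ≤ Submodule.map₂ b (⨆ i, dsM b M m ⊓ Lc i)
        (⨆ i, dsM b M m ⊓ Lc i) := Submodule.map₂_le_map₂ ih ih
    refine h.trans ?_
    rw [Submodule.map₂_iSup_left]
    refine iSup_le fun i => ?_
    rw [Submodule.map₂_iSup_right]
    refine iSup_le fun j => ?_
    refine le_trans (le_inf ?_ ?_) (le_iSup (fun i => dsM b M (m + 1) ⊓ Lc i) (i + j))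
    · exact Submodule.map₂_le_map₂ inf_le_left inf_le_left
    · exact (Submodule.map₂_le_map₂ inf_le_right inf_le_right).trans (hmul i j)

theorem part_one
    (hLT : ∀ x y z : L, ∃ α β : K, α ≠ 0 ∧
      b (b x y) z = α • b x (b y z) + β • b (b x z) y)
    (hn : 0 < n) (hind : iSupIndep Lc)
    (hmul : ∀ i j : ZMod n, Submodule.map₂ b (Lc i) (Lc j) ≤ Lc (i + j))
    (h0 : Lc 0 = ⊥) (hw : StrictMono w) (hwrange : ∀ i, 0 < w i ∧ w i < n)
    (hnz : ∀ i : ZMod n, Lc i ≠ ⊥ → ∃ j : Fin d, i = (w j : ZMod n))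
    (M : Submodule K L) (hM : Submodule.map₂ b M M ≤ M) (hMh : M ≤ ⨆ i, M ⊓ Lc i)
    (k : Fin d) (N : Submodule K L)
    (hN : N ≤ Submodule.map₂ b M (genSubalg b (topPart Lc w M k))) :
    N ⊓ Lc ((w k : ZMod n)) ≤ genSubalg b (topPart Lc w M (k + 1)) := by
  set G := genSubalg b (topPart Lc w M (k + 1)) with hG
  have hpart : ∀ j : Fin d, k < j → M ⊓ Lc (w j) ≤ G := fun j hj =>
    le_trans (le_iSup₂_of_le j (Nat.succ_le_of_lt hj) le_rfl) (le_gen b _)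
  have h1 : Submodule.map₂ b M (topPart Lc w M k) ≤
      (G ⊓ Lc (w k)) ⊔ ⨆ i, ⨆ _ : i ≠ (w k : ZMod n), Lc i := by
    refine (Submodule.map₂_le_map₂_left hMh).trans ?_
    rw [Submodule.map₂_iSup_left]
    refine iSup_le fun i => ?_
    unfold topPart
    rw [Submodule.map₂_iSup_right]
    refine iSup_le fun j => ?_
    rw [Submodule.map₂_iSup_right]
    refine iSup_le fun hj => ?_
    have hle : Submodule.map₂ b (M ⊓ Lc i) (M ⊓ Lc (w j)) ≤ Lc (i + w j) :=
      (Submodule.map₂_le_map₂ inf_le_right inf_le_right).trans (hmul _ _)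
    by_cases hij : i + (w j : ZMod n) = w k
    · refine le_trans (le_inf ?_ (hij ▸ hle)) le_sup_left
      by_cases hi : Lc i = ⊥
      · rw [hi]; simp
      obtain ⟨l, rfl⟩ := hnz i hi
      have hmod : (w l + w j) % n = w k % n := by
        have : ((w l + w j : ℕ) : ZMod n) = (w k : ℕ) := by push_cast; exact hij
        exact (ZMod.natCast_eq_natCast_iff _ _ _).1 this
      have hl := hwrange l
      have hj' := hwrange j
      have hk' := hwrange k
      have hkj : w k ≤ w j := hw.monotone (show k ≤ j from hj)
      rw [Nat.mod_eq_of_lt hk'.2] at hmod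
      have hge : n ≤ w l + w j := by
        by_contra hlt
        rw [Nat.mod_eq_of_lt (by omega)] at hmod
        omega
      rw [Nat.mod_eq_sub_mod hge, Nat.mod_eq_of_lt (by omega)] at hmod
      have hkl : k < l := hw.lt_iff_lt.1 (by omega)
      have hkj' : k < j := hw.lt_iff_lt.1 (by omega)
      exact (Submodule.map₂_le_map₂ (hpart l hkl) (hpart j hkj')).trans (gen_closed b _)
    · exact le_trans (le_trans hle (le_iSup₂_of_le (i + (w j : ZMod n)) hij le_rfl)) le_sup_right
  rintro x ⟨hxN, hxk⟩
  have hx := h1 (mul_gen_le b hLT M _ hM (topPart_le Lc w M k) (hN hxN))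
  obtain ⟨g, hg, r, hr, rfl⟩ := Submodule.mem_sup.1 hx
  have hrk : r ∈ Lc (w k) := by
    have := Submodule.sub_mem _ hxk hg.2
    rwa [add_sub_cancel_left] at this
  have : r = 0 := by
    have := (Submodule.disjoint_def.1 (hind (w k : ZMod n))) r hrk hr
    exact this
  rw [this, add_zero]
  exact hg.1

theorem part_two
    (hLT : ∀ x y z : L, ∃ α β : K, α ≠ 0 ∧
      b (b x y) z = α • b x (b y z) + β • b (b x z) y)
    (hn : 0 < n) (hind : iSupIndep Lc)
    (hmul : ∀ i j : ZMod n, Submodule.map₂ b (Lc i) (Lc j) ≤ Lc (i + j))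
    (h0 : Lc 0 = ⊥) (hw : StrictMono w) (hwrange : ∀ i, 0 < w i ∧ w i < n)
    (hnz : ∀ i : ZMod n, Lc i ≠ ⊥ → ∃ j : Fin d, i = (w j : ZMod n))
    (k : ℕ) (hk : k ≤ d) : ∀ (M : Submodule K L) (_ : Submodule.map₂ b M M ≤ M)
    (_ : M ≤ ⨆ i, M ⊓ Lc i),
    dsM b M (2 ^ k - 1) ≤ genSubalg b (topPart Lc w M k) := by
  induction k with
  | zero =>
    intro M hM hMh
    refine le_trans (hMh.trans ?_) (le_gen b _)
    refine iSup_le fun i => ?_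
    by_cases hi : Lc i = ⊥
    · rw [hi]; simp
    obtain ⟨l, rfl⟩ := hnz i hi
    exact le_iSup₂_of_le (f := fun (j : Fin d) (_ : 0 ≤ (j : ℕ)) => M ⊓ Lc (w j)) l
      (Nat.zero_le _) le_rfl
  | succ k ih =>
    intro M hM hMh
    have hNle := dsM_le b M hM (2 ^ k - 1 + 1)
    have h := ih (by omega) (dsM b M (2 ^ k - 1 + 1)) (dsM_closed b M hM _)
      (dsM_homog b Lc hmul M hMh _)
    rw [dsM_add] at h
    have hpos : 0 < 2 ^ k := by positivity
    have e : 2 ^ k - 1 + 1 + (2 ^ k - 1) = 2 ^ (k + 1) - 1 := by rw [pow_succ]; omega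
    rw [e] at h
    refine h.trans (gen_le b _ _ ?_ (gen_closed b _))
    refine iSup₂_le fun j hj => ?_
    rcases Nat.eq_or_lt_of_le hj with hj | hj
    · subst hj
      exact part_one b Lc w hLT hn hind hmul h0 hw hwrange hnz M hM hMh j _
        (Submodule.map₂_le_map₂ (dsM_le b M hM _) (ih (by omega) M hM hMh))
    · exact le_trans (inf_le_inf_right _ hNle)
        (le_trans (le_iSup₂_of_le (f := fun (j : Fin d) (_ : k + 1 ≤ (j : ℕ)) => M ⊓ Lc (w j))
          j hj le_rfl) (le_gen b _))

end aux

/-- Let `L = ⊕ L_i` be a `(ℤ/nℤ)`-graded Lie type algebra with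
`L₀ = 0`, and let `0 < w₁ < ⋯ < w_d < n` be the indices of all nonzero components.
Then for every `k` with `1 ≤ k ≤ d` (here `k` is the 0-based index `k : Fin d`):
(i) `L^{(2^{k-1})} ∩ L_{w_k} ⊆ ⟨L_{w_{k+1}},…,L_{w_d}⟩`, and
(ii) `L^{(2^k - 1)} ⊆ ⟨L_{w_{k+1}},…,L_{w_d}⟩`. -/
theorem stmt9 {K L : Type*} [Field K] [AddCommGroup L] [Module K L]
    (b : L →ₗ[K] L →ₗ[K] L)
    (hLT : ∀ x y z : L, ∃ α β : K, α ≠ 0 ∧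
      b (b x y) z = α • b x (b y z) + β • b (b x z) y)
    (n d : ℕ) (hn : 0 < n)
    (Lc : ZMod n → Submodule K L)
    (hinternal : DirectSum.IsInternal Lc)
    (hmul : ∀ i j : ZMod n, Submodule.map₂ b (Lc i) (Lc j) ≤ Lc (i + j))
    (h0 : Lc 0 = ⊥)
    (w : Fin d → ℕ) (hw : StrictMono w)
    (hwrange : ∀ i, 0 < w i ∧ w i < n)
    (hnonzero : ∀ i : ZMod n, Lc i ≠ ⊥ ↔ ∃ j : Fin d, i = (w j : ZMod n)) :
    ∀ k : Fin d,
      ds b (2 ^ (k : ℕ)) ⊓ Lc ((w k : ZMod n)) ≤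
        genSubalg b (⨆ j : Fin d, ⨆ _ : k < j, Lc ((w j : ZMod n))) ∧
      ds b (2 ^ ((k : ℕ) + 1) - 1) ≤
        genSubalg b (⨆ j : Fin d, ⨆ _ : k < j, Lc ((w j : ZMod n))) := by
  intro k
  have hind := hinternal.submodule_iSupIndep
  have hnz := fun i => (hnonzero i).1
  have hM : Submodule.map₂ b ⊤ ⊤ ≤ (⊤ : Submodule K L) := le_top
  have hMh : (⊤ : Submodule K L) ≤ ⨆ i, ⊤ ⊓ Lc i := by
    simp only [top_inf_eq]
    exact hinternal.submodule_iSup_eq_top.ge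
  have hT : (⨆ j : Fin d, ⨆ _ : k < j, Lc ((w j : ZMod n))) = topPart Lc w ⊤ (k + 1) := by
    simp only [topPart, top_inf_eq]
    rfl
  rw [hT]
  constructor
  · refine part_one b Lc w hLT hn hind hmul h0 hw hwrange hnz ⊤ hM hMh k _ ?_
    have h := part_two b Lc w hLT hn hind hmul h0 hw hwrange hnz k k.2.le ⊤ hM hMh
    have hpos : 0 < 2 ^ (k : ℕ) := by positivity
    have e : 2 ^ (k : ℕ) = 2 ^ (k : ℕ) - 1 + 1 := by omega
    rw [dsM_top] at h
    rw [e]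
    exact Submodule.map₂_le_map₂ le_top h
  · have h := part_two b Lc w hLT hn hind hmul h0 hw hwrange hnz (k + 1) k.2 ⊤ hM hMh
    rwa [dsM_top] at h
end

section
/- Suppose a metabelian (ℤ/nℤ)-graded Lie type algebra L with L_0 = 0 satisfies the selective c-nilpotency condition, and let m = m(c,q) be such that [L, L_b,…,L_b] = 0 with m copies of L_b for every b ∈ ℤ/nℤ. Set g = (m−1)(q^{c+1}+c) + 2. Then for all nonzero a_1,…,a_g ∈ ℤ/nℤ, the left-normalized product [[L,L]_{a_1}, L_{a_2},…,L_{a_g}] = 0; hence L is nilpotent of class at most g. -/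
/-- `r`-dependence of a sequence in `ℤ/nℤ`. -/
def rDep (n q r : ℕ) {k : ℕ} (a : Fin k → ZMod n) : Prop :=
  ∃ α : Fin k → ℕ, (∀ i, α i < q) ∧ α ≠ 0 ∧
    ∑ i, a i = ∑ i, (r : ZMod n) ^ (α i) * a i

/-- Left-normalized simple product `[a₁,…,a_s]`. -/
def sProd {K L : Type*} [Field K] [AddCommGroup L] [Module K L]
    (b : L →ₗ[K] L →ₗ[K] L) : List L → L
  | [] => 0
  | x :: xs => xs.foldl (fun acc y => b acc y) x

/-- Lower central series: `lcs b 0 = L` (`γ₁`), `lcs b (k+1) = [lcs b k, L]`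
(so `lcs b k = γ_{k+1}(L)`). -/
def lcs {K L : Type*} [Field K] [AddCommGroup L] [Module K L]
    (b : L →ₗ[K] L →ₗ[K] L) : ℕ → Submodule K L
  | 0 => ⊤
  | k + 1 => Submodule.map₂ b (lcs b k) ⊤

open Submodule in
theorem aux_foldl_bot {K L : Type*} [Field K] [AddCommGroup L] [Module K L]
    (b : L →ₗ[K] L →ₗ[K] L) (Ts : List (Set L)) : ∀ (S0 : Set L),
    (∀ x ∈ S0, ∀ ys : List L, List.Forall₂ (fun y T => y ∈ T) ys Ts →
      ys.foldl (fun acc y => b acc y) x = 0) →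
    (Ts.map (span K)).foldl (map₂ b) (span K S0) = ⊥ := by
  induction Ts with
  | nil =>
    intro S0 h
    simp only [List.map_nil, List.foldl_nil]
    rw [span_eq_bot]
    intro x hx
    exact h x hx [] List.Forall₂.nil
  | cons T Ts ih =>
    intro S0 h
    simp only [List.map_cons, List.foldl_cons]
    rw [map₂_span_span]
    apply ih
    rintro _ ⟨x, hx, y, hy, rfl⟩ ys hys
    exact h x hx (y :: ys) (List.Forall₂.cons hy hys)

theorem aux_fold_mem {K L : Type*} [Field K] [AddCommGroup L] [Module K L]
    (b : L →ₗ[K] L →ₗ[K] L) (V : Submodule K L) (ys : List L) : (∀ y ∈ ys, y ∈ V) →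
    ∀ (P : Submodule K L) (x : L), x ∈ P →
      ys.foldl (fun acc y => b acc y) x ∈
        (List.replicate ys.length V).foldl (Submodule.map₂ b) P := by
  induction ys with
  | nil => intro _ P x hx; simpa using hx
  | cons y ys ih =>
    intro h P x hx
    simp only [List.foldl_cons, List.length_cons, List.replicate_succ]
    apply ih (fun z hz => h z (List.mem_cons_of_mem _ hz))
    exact Submodule.apply_mem_map₂ _ hx (h y List.mem_cons_self)

theorem aux_fold_smul {K L : Type*} [Field K] [AddCommGroup L] [Module K L]
    (b : L →ₗ[K] L →ₗ[K] L) (ys : List L) : ∀ (k : K) (x : L),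
      ys.foldl (fun acc y => b acc y) (k • x) = k • ys.foldl (fun acc y => b acc y) x := by
  induction ys with
  | nil => intro k x; rfl
  | cons y ys ih =>
    intro k x
    simp only [List.foldl_cons, map_smul, LinearMap.smul_apply]
    exact ih _ _

theorem aux_fold_zero {K L : Type*} [Field K] [AddCommGroup L] [Module K L]
    (b : L →ₗ[K] L →ₗ[K] L) (ys : List L) :
      ys.foldl (fun acc y => b acc y) 0 = 0 := by
  have := aux_fold_smul b ys 0 0
  simpa using this

theorem aux_perm {K L : Type*} [Field K] [AddCommGroup L] [Module K L]
    (b : L →ₗ[K] L →ₗ[K] L)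
    (hLT : ∀ x y z : L, ∃ α β : K, α ≠ 0 ∧
      b (b x y) z = α • b x (b y z) + β • b (b x z) y)
    (hmeta : Submodule.map₂ b (Submodule.map₂ b ⊤ ⊤) (Submodule.map₂ b ⊤ ⊤) = ⊥)
    {ys zs : List L} (hp : ys.Perm zs) : ∀ x ∈ Submodule.map₂ b ⊤ ⊤,
      ys.foldl (fun acc y => b acc y) x = 0 → zs.foldl (fun acc y => b acc y) x = 0 := by
  induction hp with
  | nil => intro x _ h; exact h
  | cons y _ ih =>
    intro x hx h
    exact ih _ (Submodule.apply_mem_map₂ _ trivial trivial) h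
  | swap y z l =>
    intro x hx h
    simp only [List.foldl_cons] at h ⊢
    obtain ⟨α, β, -, e⟩ := hLT x y z
    have h0 : b x (b y z) = 0 := by
      have : b x (b y z) ∈ Submodule.map₂ b (Submodule.map₂ b ⊤ ⊤) (Submodule.map₂ b ⊤ ⊤) :=
        Submodule.apply_mem_map₂ _ hx (Submodule.apply_mem_map₂ _ trivial trivial)
      rw [hmeta] at this
      simpa using this
    rw [e, h0, smul_zero, zero_add, aux_fold_smul, h, smul_zero]
  | trans _ _ ih1 ih2 =>
    intro x hx h
    exact ih2 x hx (ih1 x hx h)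

theorem aux_unit (n q r : ℕ)
    (hprim : ∀ d : ℕ, d ∣ n → 1 < d → orderOf ((r : ZMod d)) = q)
    (e : ℕ) (he : e ≠ 0) (heq : e < q) : IsUnit (1 - (r : ZMod n) ^ e) := by
  have : (1 - (r : ZMod n) ^ e) = ((1 - (r : ℤ) ^ e : ℤ) : ZMod n) := by push_cast; rfl
  rw [this, ZMod.coe_int_isUnit_iff_isCoprime, Int.isCoprime_iff_gcd_eq_one]
  by_contra hg
  obtain ⟨p, hp, hpd⟩ := Nat.exists_prime_and_dvd hg
  have h1 : (p : ℤ) ∣ n := (Int.natCast_dvd_natCast.2 hpd).trans (Int.gcd_dvd_left _ _)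
  have h2 : (p : ℤ) ∣ 1 - (r : ℤ) ^ e :=
    (Int.natCast_dvd_natCast.2 hpd).trans (Int.gcd_dvd_right _ _)
  have ho := hprim p (Int.natCast_dvd_natCast.1 h1) hp.one_lt
  rw [← ZMod.intCast_zmod_eq_zero_iff_dvd _ p] at h2
  push_cast at h2
  have h3 : (r : ZMod p) ^ e = 1 := (sub_eq_zero.1 h2).symm
  have h4 := orderOf_dvd_of_pow_eq_one h3
  rw [ho] at h4
  exact absurd (Nat.le_of_dvd (Nat.pos_of_ne_zero he) h4) (by omega)

theorem aux_indep (n q r c : ℕ)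
    (hprim : ∀ d : ℕ, d ∣ n → 1 < d → orderOf ((r : ZMod d)) = q)
    (S : Finset (ZMod n)) (hS : q ^ (c + 1) + c < S.card) (a : ZMod n) (ha : a ≠ 0) :
    ∀ k ≤ c, ∃ t : Fin k → ZMod n, Function.Injective t ∧ (∀ i, t i ∈ S) ∧
      ¬ rDep n q r (Fin.cons a t : Fin (k + 1) → ZMod n) := by
  classical
  intro k
  induction k with
  | zero =>
    intro _
    refine ⟨Fin.elim0, fun i => i.elim0, fun i => i.elim0, ?_⟩
    rintro ⟨α, h1, h2, h3⟩
    simp at h3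
    have h0 : α 0 ≠ 0 := by
      intro h
      apply h2
      funext i
      fin_cases i
      exact h
    have hu := aux_unit n q r hprim (α 0) h0 (h1 0)
    apply ha
    rw [← hu.mul_right_eq_zero]
    linear_combination h3
  | succ k ih =>
    intro hk
    obtain ⟨t, ht, htS, hind⟩ := ih (by omega)
    let d : Fin (k + 1) → ZMod n := Fin.cons a t
    let F : (Fin (k + 2) → Fin q) → ZMod n := fun α =>
      Ring.inverse (1 - (r : ZMod n) ^ (α (Fin.last _) : ℕ)) *
        (∑ i, (r : ZMod n) ^ (α (Fin.castSucc i) : ℕ) * d i - ∑ i, d i)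
    let B : Finset (ZMod n) := Finset.univ.image F ∪ Finset.univ.image t
    have hB : B.card < S.card := by
      have e1 : (Finset.univ.image F).card ≤ q ^ (k + 2) := by
        refine Finset.card_image_le.trans ?_
        simp
      have e2 : (Finset.univ.image t).card ≤ k := by
        refine Finset.card_image_le.trans ?_
        simp
      have e3 : q ^ (k + 2) ≤ q ^ (c + 1) := by
        rcases Nat.eq_zero_or_pos q with rfl | hq
        · simp
        · exact Nat.pow_le_pow_right hq (by omega)
      have e4 : B.card ≤ _ := Finset.card_union_le _ _
      omega
    obtain ⟨x, hxS, hxB⟩ := Finset.exists_mem_notMem_of_card_lt_card hB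
    have hxF : ∀ α, F α ≠ x := by
      intro α h
      exact hxB (Finset.mem_union_left _ (Finset.mem_image.2 ⟨α, Finset.mem_univ _, h⟩))
    have hxt : ∀ i, t i ≠ x := by
      intro i h
      exact hxB (Finset.mem_union_right _ (Finset.mem_image.2 ⟨i, Finset.mem_univ _, h⟩))
    refine ⟨Fin.snoc t x, ?_, ?_, ?_⟩
    · rw [Fin.snoc_injective_iff]
      refine ⟨ht, ?_⟩
      rintro ⟨i, hi⟩
      exact hxt i hi
    · intro i
      refine Fin.lastCases ?_ (fun j => ?_) i
      · simpa using hxS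
      · simpa using htS j
    · rw [Fin.cons_snoc_eq_snoc_cons]
      change ¬ rDep n q r (Fin.snoc d x : Fin (k + 2) → ZMod n)
      rintro ⟨α, h1, h2, h3⟩
      have e1 := Fin.sum_univ_castSucc (Fin.snoc d x : Fin (k + 2) → ZMod n)
      have e2 := Fin.sum_univ_castSucc
        (fun i => (r : ZMod n) ^ α i * (Fin.snoc d x : Fin (k + 2) → ZMod n) i)
      rw [e1, e2] at h3
      simp only [Fin.snoc_castSucc, Fin.snoc_last] at h3
      by_cases hl : α (Fin.last _) = 0
      · rw [hl] at h3
        apply hind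
        refine ⟨fun i => α (Fin.castSucc i), fun i => h1 _, ?_, ?_⟩
        · intro h
          apply h2
          funext i
          refine Fin.lastCases hl (fun j => ?_) i
          exact congrFun h j
        · change ∑ i, d i = ∑ i, (r : ZMod n) ^ α (Fin.castSucc i) * d i
          simpa using h3
      · have hu := aux_unit n q r hprim _ hl (h1 _)
        apply hxF (fun i => ⟨α i, h1 i⟩)
        change Ring.inverse (1 - (r : ZMod n) ^ (α (Fin.last _))) *
          (∑ i, (r : ZMod n) ^ (α (Fin.castSucc i)) * d i - ∑ i, d i) = x
        have h5 : ∑ i, (r : ZMod n) ^ (α (Fin.castSucc i)) * d i - ∑ i, d i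
            = (1 - (r : ZMod n) ^ (α (Fin.last _))) * x := by
          linear_combination -h3
        rw [h5, Ring.inverse_mul_cancel_left _ _ hu]

theorem aux_core {K L : Type*} [Field K] [AddCommGroup L] [Module K L]
    (b : L →ₗ[K] L →ₗ[K] L)
    (hLT : ∀ x y z : L, ∃ α β : K, α ≠ 0 ∧
      b (b x y) z = α • b x (b y z) + β • b (b x z) y)
    (n q r c m : ℕ)
    (hprim : ∀ d : ℕ, d ∣ n → 1 < d → orderOf ((r : ZMod d)) = q)
    (Lc : ZMod n → Submodule K L)
    (hmeta : Submodule.map₂ b (Submodule.map₂ b ⊤ ⊤) (Submodule.map₂ b ⊤ ⊤) = ⊥)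
    (hsel : ∀ (d : Fin (c + 1) → ZMod n) (x : Fin (c + 1) → L), (∀ i, d i ≠ 0) →
      ¬ rDep n q r d → (∀ i, x i ∈ Lc (d i)) → sProd b (List.ofFn x) = 0)
    (hm : ∀ bb : ZMod n,
      (List.replicate m (Lc bb)).foldl (Submodule.map₂ b) ⊤ = ⊥)
    (x : L) (hx : x ∈ Submodule.map₂ b ⊤ ⊤) (a : ZMod n) (ha : a ≠ 0) (hxa : x ∈ Lc a)
    (ps : List (ZMod n × L)) (hps : ∀ p ∈ ps, p.1 ≠ 0 ∧ p.2 ∈ Lc p.1)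
    (hlen : ps.length = (m - 1) * (q ^ (c + 1) + c) + 1) :
    (ps.map Prod.snd).foldl (fun acc y => b acc y) x = 0 := by
  classical
  have key : ∀ l : List (ZMod n × L), l.Subperm ps →
      (l.map Prod.snd).foldl (fun acc y => b acc y) x = 0 →
      (ps.map Prod.snd).foldl (fun acc y => b acc y) x = 0 := by
    intro l hl h
    obtain ⟨l₁, hp, hs⟩ := hl
    obtain ⟨l', hl₁⟩ := hs.exists_perm_append
    have hl' : ps.Perm (l ++ l') := hl₁.trans (hp.append_right l')
    refine aux_perm b hLT hmeta (hl'.symm.map Prod.snd) x hx ?_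
    rw [List.map_append, List.foldl_append, h, aux_fold_zero]
  by_cases hcount : ∃ v, m ≤ (ps.map Prod.fst).count v
  · obtain ⟨v, hv⟩ := hcount
    let l := (ps.filter (fun p => p.1 = v)).take m
    have hsub : l.Sublist ps := (List.take_sublist _ _).trans List.filter_sublist
    have hl : l.length = m := by
      rw [List.count_eq_length_filter, List.filter_map, List.length_map] at hv
      simp only [l, List.length_take]
      apply min_eq_left
      refine hv.trans (le_of_eq ?_)
      congr 1
    apply key l hsub.subperm
    have hmem := aux_fold_mem b (Lc v) (l.map Prod.snd) (by
      intro y hy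
      obtain ⟨p, hp, rfl⟩ := List.mem_map.1 hy
      have h1 := List.mem_of_mem_take hp
      rw [List.mem_filter] at h1
      have h2 : p.1 = v := by simpa using h1.2
      exact h2 ▸ (hps p h1.1).2) ⊤ x trivial
    rw [List.length_map, hl, hm v] at hmem
    simpa using hmem
  · push Not at hcount
    let S := (ps.map Prod.fst).toFinset
    have hS : q ^ (c + 1) + c < S.card := by
      have h1 : (ps.map Prod.fst).length ≤ S.card * (m - 1) := by
        rw [← List.sum_toFinset_count_eq_length, ← smul_eq_mul]
        apply Finset.sum_le_card_nsmul
        intro v _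
        have := hcount v
        omega
      rw [List.length_map, hlen] at h1
      by_contra hc
      push Not at hc
      have := Nat.mul_le_mul_right (m - 1) hc
      rw [mul_comm (q ^ (c + 1) + c)] at this
      omega
    obtain ⟨t, htinj, htS, hind⟩ := aux_indep n q r c hprim S hS a ha c le_rfl
    have hex : ∀ i, ∃ y, (t i, y) ∈ ps := by
      intro i
      have := htS i
      simpa [S] using this
    choose y hy using hex
    apply key (List.ofFn fun i => (t i, y i))
    · apply List.Nodup.subperm
      · rw [List.nodup_ofFn]
        intro i j hij
        exact htinj (Prod.ext_iff.1 hij).1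
      · intro p hp
        obtain ⟨i, rfl⟩ := (List.mem_ofFn' _ _).1 hp
        exact hy i
    · have := hsel (Fin.cons a t) (Fin.cons x y) (by
        intro i
        refine Fin.cases ?_ (fun j => ?_) i
        · simpa using ha
        · simpa using (hps _ (hy j)).1) hind (by
        intro i
        refine Fin.cases ?_ (fun j => ?_) i
        · simpa using hxa
        · simpa using (hps _ (hy j)).2)
      simp only [List.ofFn_succ, Fin.cons_zero, Fin.cons_succ, sProd] at this
      rw [List.map_ofFn]
      exact this

theorem aux_lcs {K L : Type*} [Field K] [AddCommGroup L] [Module K L]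
    (b : L →ₗ[K] L →ₗ[K] L) (k : ℕ) :
    lcs b (k + 1) = (List.replicate k ⊤).foldl (Submodule.map₂ b) (Submodule.map₂ b ⊤ ⊤) := by
  induction k with
  | zero => rfl
  | succ k ih =>
    rw [List.replicate_succ', List.foldl_append, ← ih]
    rfl

/-- Suppose a metabelian `(ℤ/nℤ)`-graded Lie type algebra `L` with
`L₀ = 0` satisfies the selective `c`-nilpotency condition, and `m = m(c,q)` is such
that `[L, L_b,…,L_b] = 0` (`m` copies of `L_b`) for every `b ∈ ℤ/nℤ`. Set
`g = (m-1)(q^{c+1}+c) + 2`. Then for all nonzero `a₁,…,a_g ∈ ℤ/nℤ`,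
`[[L,L]_{a₁}, L_{a₂},…,L_{a_g}] = 0`; hence `L` is nilpotent of class at most `g`. -/
theorem stmt18 {K L : Type*} [Field K] [AddCommGroup L] [Module K L]
    (b : L →ₗ[K] L →ₗ[K] L)
    (hLT : ∀ x y z : L, ∃ α β : K, α ≠ 0 ∧
      b (b x y) z = α • b x (b y z) + β • b (b x z) y)
    (n q r c m : ℕ) (hn : 0 < n) (hr : 1 ≤ r ∧ r ≤ n - 1)
    (hprim : ∀ d : ℕ, d ∣ n → 1 < d → orderOf ((r : ZMod d)) = q)
    (Lc : ZMod n → Submodule K L)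
    (hinternal : DirectSum.IsInternal Lc)
    (hmul : ∀ i j : ZMod n, Submodule.map₂ b (Lc i) (Lc j) ≤ Lc (i + j))
    (h0 : Lc 0 = ⊥)
    (hmeta : Submodule.map₂ b (Submodule.map₂ b ⊤ ⊤) (Submodule.map₂ b ⊤ ⊤) = ⊥)
    (hsel : ∀ (d : Fin (c + 1) → ZMod n) (x : Fin (c + 1) → L), (∀ i, d i ≠ 0) →
      ¬ rDep n q r d → (∀ i, x i ∈ Lc (d i)) → sProd b (List.ofFn x) = 0)
    (hm : ∀ bb : ZMod n,
      (List.replicate m (Lc bb)).foldl (Submodule.map₂ b) ⊤ = ⊥) :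
    (∀ a : Fin ((m - 1) * (q ^ (c + 1) + c) + 2) → ZMod n, (∀ i, a i ≠ 0) →
       (List.ofFn fun i : Fin ((m - 1) * (q ^ (c + 1) + c) + 1) =>
           Lc (a i.succ)).foldl (Submodule.map₂ b)
         (Submodule.map₂ b ⊤ ⊤ ⊓ Lc (a ⟨0, by omega⟩)) = ⊥) ∧
    lcs b ((m - 1) * (q ^ (c + 1) + c) + 2) = ⊥ := by
  constructor
  · intro a ha
    let N := (m - 1) * (q ^ (c + 1) + c) + 1
    have h := aux_foldl_bot b (List.ofFn fun i : Fin N => (Lc (a i.succ) : Set L))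
      ((Submodule.map₂ b ⊤ ⊤ ⊓ Lc (a ⟨0, by omega⟩) : Submodule K L) : Set L) ?_
    · rw [List.map_ofFn] at h
      simpa [Function.comp_def, N] using h
    · rintro x ⟨hx, hxa⟩ ys hys
      have hl : ys.length = N := by simpa using hys.length_eq
      have hc := aux_core b hLT n q r c m hprim Lc hmeta hsel hm x hx _ (ha _) hxa
        ((List.ofFn fun i : Fin N => a i.succ).zip ys) ?_ ?_
      · rwa [List.map_snd_zip (by simp [hl, N])] at hc
      · intro p hp
        obtain ⟨i, hi, rfl⟩ := List.mem_iff_getElem.1 hp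
        simp only [List.getElem_zip, List.getElem_ofFn]
        refine ⟨ha _, ?_⟩
        have := hys.get (i := i) (by simp at hi; omega) (by simp at hi; simp; omega)
        rw [List.get_eq_getElem, List.get_eq_getElem, List.getElem_ofFn] at this
        exact this
      · simp [hl, N]
  · let T : Set L := {y | ∃ i, i ≠ 0 ∧ y ∈ Lc i}
    let S : Set L := {y | y ∈ Submodule.map₂ b ⊤ ⊤ ∧ ∃ i, i ≠ 0 ∧ y ∈ Lc i}
    have hT : Submodule.span K T = ⊤ := by
      rw [eq_top_iff, ← hinternal.submodule_iSup_eq_top]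
      apply iSup_le
      intro i
      by_cases hi : i = 0
      · rw [hi, h0]; exact bot_le
      · intro y hy
        exact Submodule.subset_span ⟨i, hi, hy⟩
    have hSp : Submodule.span K S = Submodule.map₂ b ⊤ ⊤ := by
      apply le_antisymm
      · rw [Submodule.span_le]
        intro y hy
        exact hy.1
      · conv_lhs => rw [← hT]
        rw [Submodule.map₂_span_span, Submodule.span_le]
        rintro _ ⟨x, ⟨i, hi, hx⟩, y, ⟨j, hj, hy⟩, rfl⟩
        have hxy : b x y ∈ Lc (i + j) := hmul i j (Submodule.apply_mem_map₂ _ hx hy)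
        by_cases hij : i + j = 0
        · rw [hij, h0, Submodule.mem_bot] at hxy
          change b x y ∈ _
          rw [hxy]
          exact Submodule.zero_mem _
        · exact Submodule.subset_span
            ⟨Submodule.apply_mem_map₂ _ trivial trivial, i + j, hij, hxy⟩
    rw [aux_lcs, ← hSp]
    have h := aux_foldl_bot b (List.replicate ((m - 1) * (q ^ (c + 1) + c) + 1) T) S ?_
    · rwa [List.map_replicate, hT] at h
    · rintro x ⟨hx, a, ha, hxa⟩ ys hys
      have hl : ys.length = (m - 1) * (q ^ (c + 1) + c) + 1 := by simpa using hys.length_eq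
      have hyT : ∀ y ∈ ys, ∃ i, i ≠ 0 ∧ y ∈ Lc i := by
        intro y hy
        obtain ⟨i, hi, rfl⟩ := List.mem_iff_getElem.1 hy
        have := hys.get (i := i) hi (by simp; omega)
        simpa [T] using this
      classical
      let f : L → ZMod n := fun y => if h : ∃ i, i ≠ 0 ∧ y ∈ Lc i then h.choose else 0
      have hf : ∀ y ∈ ys, f y ≠ 0 ∧ y ∈ Lc (f y) := by
        intro y hy
        have h := hyT y hy
        simp only [f, dif_pos h]
        exact h.choose_spec
      have hc := aux_core b hLT n q r c m hprim Lc hmeta hsel hm x hx a ha hxa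
        (ys.map fun y => (f y, y)) ?_ (by simpa using hl)
      · simpa [Function.comp_def] using hc
      · intro p hp
        obtain ⟨y, hy, rfl⟩ := List.mem_map.1 hp
        exact hf y hy
end
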